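/- arXiv:0708.2838 — 6 statements merged into one kernel-verified Lean document; each statement's English description precedes it below -/
import Mathlib

section
/- Let (W_i)_{i∈I} be a family of nonempty topological spaces and suppose that the product Z = ∏_{i∈I} W_i, with the product topology, is semilocally contractible. Then all but finitely many of the spaces W_i are contractible; that is, the set {i ∈ I : W_i is not contractible} is finite. -/
universe u v

/-- A space is semilocally contractible if every point has a neighbourhood which
deforms, within the whole space, to a point. -/
def SemilocallyContractible (Z : Type u) [TopologicalSpace Z] : Prop :=
  ∀ z : Z, ∃ U : Set Z, U ∈ nhds z ∧
    ∃ H : C(↥U × unitInterval, Z),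
      (∀ x : ↥U, H (x, 0) = (x : Z)) ∧ ∃ z' : Z, ∀ x : ↥U, H (x, 1) = z'

/-- A space that is a retract of `Z`, via a section landing in a subset `U` which deforms within
`Z` to a point, is contractible. -/
theorem ContractibleSpace.of_section_of_deformation {X : Type*} {Z : Type*} [TopologicalSpace X]
    [TopologicalSpace Z] {U : Set Z} (s : C(X, U)) (r : C(Z, X))
    (hrs : ∀ x, r (s x : Z) = x) (H : C(U × unitInterval, Z)) (h₀ : ∀ x : U, H (x, 0) = x)
    {z : Z} (h₁ : ∀ x : U, H (x, 1) = z) : ContractibleSpace X := by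
  rw [contractible_iff_id_nullhomotopic]
  refine ⟨r z, ⟨⟨⟨fun p => r (H (s p.2, p.1)), by fun_prop⟩, fun x => ?_, fun x => ?_⟩⟩⟩
  · simp [h₀, hrs]
  · simp [h₁]

/-- If a product of nonempty spaces is semilocally contractible, then all but finitely
many of the factors are contractible. -/
theorem finitely_many_noncontractible_factors_of_semilocallyContractible_prod
    (ι : Type v) (W : ι → Type u) [∀ i, TopologicalSpace (W i)]
    (hne : ∀ i, Nonempty (W i))
    (h : SemilocallyContractible (∀ i, W i)) :
    { i : ι | ¬ ContractibleSpace (W i) }.Finite := by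
  classical
  let z : ∀ i, W i := fun i => (hne i).some
  obtain ⟨U, hU, H, h₀, z', h₁⟩ := h z
  rw [nhds_pi, Filter.mem_pi] at hU
  obtain ⟨I, hI, V, hV, hVU⟩ := hU
  refine hI.subset fun i hi => ?_
  by_contra hiI
  have hmem (w : W i) : Function.update z i w ∈ U := by
    refine hVU fun j hj => ?_
    rw [Function.update_of_ne (ne_of_mem_of_not_mem hj hiI)]
    exact mem_of_mem_nhds (hV j)
  exact hi <| .of_section_of_deformation
    ⟨fun w => ⟨Function.update z i w, hmem w⟩, by fun_prop⟩
    ⟨fun x => x i, continuous_apply i⟩ (fun w => by simp) H h₀ h₁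
end

section
/- Let X be a compactly generated Hausdorff space, let L, A_1, …, A_n be closed subsets of X, and let Y be a topological space with subsets B_1, …, B_n. Suppose there exists a retraction ρ : X × [0,1] → X × {0} ∪ L × [0,1] (a continuous map restricting to the identity on X × {0} ∪ L × [0,1]) such that ρ(A_i × [0,1]) ⊆ A_i × {0} ∪ (A_i ∩ L) × [0,1] for each i. Then the restriction map {f ∈ C(X,Y) : f(A_i) ⊆ B_i for all i} → {g ∈ C(L,Y) : g(A_i ∩ L) ⊆ B_i for all i}, f ↦ f|_L, is a fibration, where all mapping spaces carry the compact-open topology and these subsets the subspace topology. -/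
universe u v w

/-- A (Hurewicz) fibration: a continuous map with the homotopy lifting property
with respect to all topological spaces. -/
def IsFibration {E : Type*} {B : Type*} [TopologicalSpace E] [TopologicalSpace B]
    (p : E → B) : Prop :=
  Continuous p ∧
    ∀ (T : Type w) [TopologicalSpace T] (H : C(T × unitInterval, B)) (f : C(T, E)),
      (∀ t, p (f t) = H (t, 0)) →
        ∃ H' : C(T × unitInterval, E), (∀ x, p (H' x) = H x) ∧ ∀ t, H' (t, 0) = f t

/-- A space is compactly generated if a set is closed as soon as its preimage under
every continuous map from a compact Hausdorff space is closed. -/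
def CompactlyGeneratedTop (X : Type u) [TopologicalSpace X] : Prop :=
  ∀ A : Set X,
    (∀ (K : Type w) [TopologicalSpace K] [CompactSpace K] [T2Space K] (f : C(K, X)),
      IsClosed (⇑f ⁻¹' A)) → IsClosed A

open Set Topology

/-- A map out of a compactly generated space is continuous as soon as its restrictions to compact
subsets are. -/
theorem CompactlyGeneratedTop.continuous_of_continuousOn_isCompact {X Y : Type*}
    [TopologicalSpace X] [TopologicalSpace Y] (hX : CompactlyGeneratedTop X) {g : X → Y}
    (hg : ∀ K : Set X, IsCompact K → ContinuousOn g K) : Continuous g := by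
  refine continuous_iff_isClosed.2 fun C hC => hX _ fun K _ _ _ k => ?_
  have hgk : Continuous (g ∘ k) :=
    (hg _ (isCompact_range k.continuous)).comp_continuous k.continuous mem_range_self
  exact hC.preimage hgk

/-- Evaluation is jointly continuous along points which stay in a compact Hausdorff subset. -/
theorem ContinuousMap.continuous_apply_of_mem_isCompact {W X Y : Type*} [TopologicalSpace W]
    [TopologicalSpace X] [TopologicalSpace Y] [T2Space X] {K : Set X} (hK : IsCompact K)
    {u : W → C(X, Y)} {v : W → X} (hu : Continuous u) (hv : Continuous v) (hvK : ∀ w, v w ∈ K) :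
    Continuous fun w => u w (v w) := by
  have : CompactSpace K := isCompact_iff_compactSpace.1 hK
  have huK : Continuous fun w => (u w).restrict K := (continuous_restrict K).comp hu
  exact huK.eval (hv.subtype_mk hvK)

/-- A family of maps out of `X` is continuous in the compact-open topology if it is jointly
continuous over each compact subset of `X`. -/
theorem ContinuousMap.continuous_of_forall_isCompact {W X Y : Type*} [TopologicalSpace W]
    [TopologicalSpace X] [TopologicalSpace Y] {u : W → C(X, Y)}
    (hu : ∀ K : Set X, IsCompact K → Continuous fun p : W × K => u p.1 p.2) : Continuous u := by
  rw [compactOpen_eq_iInf_induced]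
  refine continuous_iInf_rng.2 fun K => continuous_iInf_rng.2 fun hK => continuous_induced_rng.2 ?_
  exact continuous_of_continuous_uncurry _ (hu K hK)

section RelativeHomotopy

variable {T X Y : Type*} [TopologicalSpace X] [TopologicalSpace Y] {L : Set X}

open Classical in
/-- The map on `X × {0} ∪ L × I` given by `h` on `L × I` and by `f` on `X × {0}`, depending on a
parameter in `T`. -/
noncomputable def relativeHomotopy (h : T × unitInterval → C(L, Y)) (f : T → C(X, Y)) (t : T)
    (z : X × unitInterval) : Y :=
  if hz : z.1 ∈ L then h (t, z.2) ⟨z.1, hz⟩ else f t z.1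

theorem relativeHomotopy_of_mem (h : T × unitInterval → C(L, Y)) (f : T → C(X, Y)) (t : T)
    {z : X × unitInterval} (hz : z.1 ∈ L) :
    relativeHomotopy h f t z = h (t, z.2) ⟨z.1, hz⟩ :=
  dif_pos hz

theorem relativeHomotopy_of_eq_zero {h : T × unitInterval → C(L, Y)} {f : T → C(X, Y)}
    (hf : ∀ t, (f t).restrict L = h (t, 0)) (t : T) {z : X × unitInterval} (hz : z.2 = 0) :
    relativeHomotopy h f t z = f t z.1 := by
  by_cases hzL : z.1 ∈ L
  · rw [relativeHomotopy_of_mem h f t hzL, hz, ← hf]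
    rfl
  · exact dif_neg hzL

theorem continuous_relativeHomotopy [TopologicalSpace T] [T2Space X] (hL : IsClosed L)
    {h : T × unitInterval → C(L, Y)} {f : T → C(X, Y)} (hh : Continuous h) (hfc : Continuous f)
    (hf : ∀ t, (f t).restrict L = h (t, 0)) {W : Type*} [TopologicalSpace W] {τ : W → T}
    {ζ : W → X × unitInterval} (hτ : Continuous τ) (hζ : Continuous ζ)
    (hζ_into : ∀ w, (ζ w).2 = 0 ∨ (ζ w).1 ∈ L) {M : Set X} (hM : IsCompact M)
    (hζM : ∀ w, (ζ w).1 ∈ M) :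
    Continuous fun w => relativeHomotopy h f (τ w) (ζ w) := by
  have hζ₁ : Continuous fun w => (ζ w).1 := hζ.fst
  have hζ₂ : Continuous fun w => (ζ w).2 := hζ.snd
  have hbot : ContinuousOn (fun w => relativeHomotopy h f (τ w) (ζ w)) {w | (ζ w).2 = 0} := by
    refine ContinuousOn.congr (f := fun w => f (τ w) (ζ w).1) ?_
      fun w hw => relativeHomotopy_of_eq_zero hf _ hw
    exact (ContinuousMap.continuous_apply_of_mem_isCompact hM (hfc.comp hτ) hζ₁ hζM).continuousOn
  have hside : ContinuousOn (fun w => relativeHomotopy h f (τ w) (ζ w)) {w | (ζ w).1 ∈ L} := by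
    rw [continuousOn_iff_continuous_domRestrict]
    have hM' : IsCompact ((↑) ⁻¹' M : Set L) :=
      hL.isClosedEmbedding_subtypeVal.isCompact_preimage hM
    have hu : Continuous fun w : {w | (ζ w).1 ∈ L} => h (τ w, (ζ w).2) :=
      hh.comp ((hτ.prodMk hζ₂).comp continuous_subtype_val)
    have hv : Continuous fun w : {w | (ζ w).1 ∈ L} => (⟨(ζ w).1, w.2⟩ : L) :=
      (hζ₁.comp continuous_subtype_val).subtype_mk _
    exact (ContinuousMap.continuous_apply_of_mem_isCompact hM' hu hv fun w => hζM w).congr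
      fun w => (relativeHomotopy_of_mem h f _ w.2).symm
  have hunion := hbot.union_of_isClosed hside (isClosed_eq hζ₂ continuous_const)
    (hL.preimage hζ₁)
  exact continuousOn_univ.1 (hunion.mono fun w _ => hζ_into w)

end RelativeHomotopy

/-- Given a suitable retraction `ρ : X × I → X × {0} ∪ L × I` compatible with the
subsets `A i`, the restriction map of `n`-ad mapping spaces (compact-open topology)
`{f : X → Y | f(Aᵢ) ⊆ Bᵢ} → {g : L → Y | g(Aᵢ ∩ L) ⊆ Bᵢ}` is a fibration. -/
theorem restriction_isFibration_of_retraction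
    (X : Type u) (Y : Type v) [TopologicalSpace X] [TopologicalSpace Y] [T2Space X]
    (hX : CompactlyGeneratedTop X)
    (n : ℕ) (L : Set X) (hL : IsClosed L)
    (A : Fin n → Set X) (hA : ∀ i, IsClosed (A i))
    (B : Fin n → Set Y)
    (ρ : C(X × unitInterval, X × unitInterval))
    (hρ_retract : ∀ z : X × unitInterval, (z.2 = 0 ∨ z.1 ∈ L) → ρ z = z)
    (hρ_into : ∀ z : X × unitInterval, (ρ z).2 = 0 ∨ (ρ z).1 ∈ L)
    (hρ_A : ∀ (i : Fin n) (z : X × unitInterval), z.1 ∈ A i →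
      (ρ z).1 ∈ A i ∧ ((ρ z).2 = 0 ∨ (ρ z).1 ∈ L)) :
    IsFibration (fun f : { f : C(X, Y) // ∀ i, Set.MapsTo ⇑f (A i) (B i) } =>
      (⟨(f.1).restrict L, fun i x hx => f.2 i hx⟩ :
        { g : C(↥L, Y) // ∀ (i : Fin n) (x : ↥L), (x : X) ∈ A i → g x ∈ B i })) := by
  refine ⟨((ContinuousMap.continuous_restrict L).comp continuous_subtype_val).subtype_mk _, ?_⟩
  intro T _ H f hHf
  let h : T × unitInterval → C(L, Y) := fun p => (H p).1
  let f₀ : T → C(X, Y) := fun t => (f t).1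
  have hh : Continuous h := continuous_subtype_val.comp H.continuous
  have hf₀ : Continuous f₀ := continuous_subtype_val.comp f.continuous
  have hf : ∀ t, (f₀ t).restrict L = h (t, 0) := fun t => congrArg Subtype.val (hHf t)
  have hjoint : ∀ K : Set X, IsCompact K → Continuous fun p : (T × unitInterval) × K =>
      relativeHomotopy h f₀ p.1.1 (ρ (p.2, p.1.2)) := fun K hK =>
    continuous_relativeHomotopy hL hh hf₀ hf (by fun_prop) (by fun_prop)
      (fun _ => hρ_into _) (((hK.prod isCompact_univ).image ρ.continuous).image continuous_fst)
      fun p => mem_image_of_mem _ (mem_image_of_mem _ ⟨p.2.2, mem_univ _⟩)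
  have hslice (p : T × unitInterval) :
      Continuous fun x => relativeHomotopy h f₀ p.1 (ρ (x, p.2)) := by
    refine hX.continuous_of_continuousOn_isCompact fun K hK => ?_
    rw [continuousOn_iff_continuous_domRestrict]
    exact (hjoint K hK).comp (Continuous.prodMk_right p)
  let G : T × unitInterval → C(X, Y) := fun p => ⟨_, hslice p⟩
  have hG : Continuous G := ContinuousMap.continuous_of_forall_isCompact hjoint
  have hGAB (p : T × unitInterval) (i : Fin n) : MapsTo (G p) (A i) (B i) := by
    intro x hx
    change relativeHomotopy h f₀ p.1 (ρ (x, p.2)) ∈ B i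
    obtain ⟨hzA, hz | hz⟩ := hρ_A i (x, p.2) hx
    · rw [relativeHomotopy_of_eq_zero hf p.1 hz]
      exact (f p.1).2 i hzA
    · rw [relativeHomotopy_of_mem h f₀ p.1 hz]
      exact (H (p.1, _)).2 i ⟨_, hz⟩ hzA
  refine ⟨⟨fun p => ⟨G p, hGAB p⟩, hG.subtype_mk _⟩, fun p => ?_, fun t => ?_⟩
  · refine Subtype.ext (ContinuousMap.ext fun x => ?_)
    change relativeHomotopy h f₀ p.1 (ρ (x, p.2)) = h p x
    rw [hρ_retract _ (Or.inr x.2), relativeHomotopy_of_mem h f₀ p.1 x.2]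
  · refine Subtype.ext (ContinuousMap.ext fun x => ?_)
    change relativeHomotopy h f₀ t (ρ (x, 0)) = f₀ t x
    rw [hρ_retract _ (Or.inl rfl), relativeHomotopy_of_eq_zero hf t rfl]
end

section
/- Let H be an abelian group admitting a finitely generated subgroup B such that the quotient H/B is p-divisible for some prime p, i.e., every element of H/B is p times an element of H/B. Then the group Hom(H, ℤ) of additive homomorphisms from H to the integers is finitely generated (hence free abelian of finite rank), and consequently there exist d ∈ ℕ and a subgroup H' ≤ H with Hom(H', ℤ) = 0 such that H is the internal direct sum of H' and a free abelian subgroup of rank d. -/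
universe u

/-- A homomorphism from a `p`-divisible abelian group to `ℤ` is zero. -/
theorem AddMonoidHom.eq_zero_of_prime_divisible {A : Type*} [AddCommGroup A] {p : ℕ}
    (hp : p.Prime) (hdiv : ∀ y : A, ∃ x : A, p • x = y) (f : A →+ ℤ) : f = 0 := by
  have hpow : ∀ (n : ℕ) (y : A), (p : ℤ) ^ n ∣ f y := by
    intro n
    induction n with
    | zero => simp
    | succ n ih =>
      intro y
      obtain ⟨x, rfl⟩ := hdiv y
      rw [map_nsmul, nsmul_eq_mul, pow_succ']
      exact mul_dvd_mul_left _ (ih x)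
  ext y
  by_contra hy
  have hfin : FiniteMultiplicity (p : ℤ) (f y) :=
    Int.finiteMultiplicity_iff.mpr ⟨by simpa using hp.ne_one, hy⟩
  obtain ⟨n, hn⟩ := hfin
  exact hn (hpow _ y)

/-- If `B` is generated by a finite set `S` and `H ⧸ B` is `p`-divisible, then a homomorphism
`H →+ ℤ` is determined by its values on `S`, so these homomorphisms form a finitely generated
group. -/
theorem Module.Finite.dual_int_of_prime_divisible_quotient {H : Type*} [AddCommGroup H]
    {B : AddSubgroup H} (hB : B.FG) {p : ℕ} (hp : p.Prime)
    (hdiv : ∀ y : H ⧸ B, ∃ x : H ⧸ B, p • x = y) : Module.Finite ℤ (Module.Dual ℤ H) := by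
  obtain ⟨S, rfl⟩ := hB
  let restrict : Module.Dual ℤ H →ₗ[ℤ] (S → ℤ) :=
    LinearMap.pi fun s => Module.Dual.eval ℤ H s
  refine Module.Finite.of_injective restrict ?_
  rw [injective_iff_map_eq_zero]
  intro φ hφ
  have hker : AddSubgroup.closure (S : Set H) ≤ φ.toAddMonoidHom.ker :=
    (AddSubgroup.closure_le _).mpr fun s hs => congrFun hφ ⟨s, hs⟩
  have hlift := AddMonoidHom.eq_zero_of_prime_divisible hp hdiv
    (QuotientAddGroup.lift _ φ.toAddMonoidHom hker)
  ext h
  exact DFunLike.congr_fun hlift (h : H ⧸ AddSubgroup.closure (S : Set H))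

/-- Over a principal ideal domain, the kernel of a linear map to a finite torsion-free module
has a finite free complement. -/
theorem LinearMap.exists_free_isCompl_ker {R M D : Type*} [CommRing R] [IsDomain R]
    [IsPrincipalIdealRing R] [AddCommGroup M] [Module R M] [AddCommGroup D] [Module R D]
    [Module.Finite R D] [Module.IsTorsionFree R D] (f : M →ₗ[R] D) :
    ∃ (d : ℕ) (F : Submodule R M),
      Nonempty (F ≃ₗ[R] (Fin d → R)) ∧ IsCompl F (LinearMap.ker f) := by
  obtain ⟨s, hs⟩ := Module.projective_lifting_property f.rangeRestrict LinearMap.id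
    f.surjective_rangeRestrict
  have hs' : ∀ x, f.rangeRestrict (s x) = x := LinearMap.congr_fun hs
  have hinj : Function.Injective s := Function.LeftInverse.injective hs'
  refine ⟨_, LinearMap.range s,
    ⟨(LinearEquiv.ofInjective s hinj).symm.trans (Module.finBasis R _).equivFun⟩, ?_⟩
  rw [← f.ker_rangeRestrict]
  constructor
  · rw [Submodule.disjoint_def]
    rintro _ ⟨x, rfl⟩ hx
    rw [LinearMap.mem_ker, hs'] at hx
    rw [hx, map_zero]
  · rw [codisjoint_iff, eq_top_iff]
    intro m _
    refine Submodule.mem_sup.mpr ⟨s (f.rangeRestrict m), ⟨_, rfl⟩,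
      m - s (f.rangeRestrict m), ?_, add_sub_cancel _ _⟩
    rw [LinearMap.mem_ker, map_sub, hs', sub_self]

/-- A module over a principal ideal domain whose dual is finite is the direct sum of a
finite free submodule and a submodule with zero dual. -/
theorem Module.Dual.exists_isCompl_free_of_finite {R M : Type*} [CommRing R] [IsDomain R]
    [IsPrincipalIdealRing R] [AddCommGroup M] [Module R M] [Module.Finite R (Module.Dual R M)] :
    ∃ (d : ℕ) (F N : Submodule R M),
      Nonempty (F ≃ₗ[R] (Fin d → R)) ∧ (∀ φ : Module.Dual R N, φ = 0) ∧ IsCompl F N := by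
  have htf : Module.IsTorsionFree R (Module.Dual R M) :=
    DFunLike.coe_injective.moduleIsTorsionFree _ fun _ _ => rfl
  obtain ⟨d, F, hF, hFN⟩ := LinearMap.exists_free_isCompl_ker (Module.Dual.eval R M)
  refine ⟨d, F, _, hF, fun φ => ?_, hFN⟩
  ext x
  have heval : φ (Submodule.projectionOnto _ F hFN.symm x) = 0 :=
    LinearMap.congr_fun (LinearMap.mem_ker.mp x.2)
      (φ ∘ₗ Submodule.projectionOnto _ F hFN.symm)
  rwa [Submodule.projectionOnto_apply_left] at heval

/-- If an abelian group `H` has a finitely generated subgroup `B` with `H/B`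
`p`-divisible for some prime `p`, then `Hom(H, ℤ)` is finitely generated, and `H`
splits as the internal direct sum of a free abelian subgroup of finite rank and a
subgroup `H'` with `Hom(H', ℤ) = 0`. -/
theorem character_group_fg_and_splitting
    (H : Type u) [AddCommGroup H] (B : AddSubgroup H) (hB : B.FG)
    (p : ℕ) (hp : Nat.Prime p)
    (hdiv : ∀ y : H ⧸ B, ∃ x : H ⧸ B, p • x = y) :
    AddGroup.FG (H →+ ℤ) ∧
    ∃ (d : ℕ) (F H' : AddSubgroup H),
      Nonempty (↥F ≃+ (Fin d → ℤ)) ∧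
      (∀ φ : ↥H' →+ ℤ, φ = 0) ∧
      F ⊓ H' = ⊥ ∧ F ⊔ H' = ⊤ := by
  have hfin := Module.Finite.dual_int_of_prime_divisible_quotient hB hp hdiv
  constructor
  · have : Module.Finite ℤ (H →+ ℤ) :=
      Module.Finite.equiv (addMonoidHomLequivInt (A := H) (B := ℤ) ℤ).symm
    exact Module.Finite.iff_addGroup_fg.mp this
  · obtain ⟨d, F, N, ⟨e⟩, hN, hFN⟩ := Module.Dual.exists_isCompl_free_of_finite (R := ℤ) (M := H)
    refine ⟨d, F.toAddSubgroup, N.toAddSubgroup, ⟨e.toAddEquiv⟩, fun φ => ?_, ?_, ?_⟩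
    · ext x
      exact LinearMap.congr_fun (hN (AddMonoidHom.toIntLinearMap (M := N) φ)) x
    · exact congrArg Submodule.toAddSubgroup hFN.inf_eq_bot
    · rw [← Submodule.sup_toAddSubgroup, hFN.sup_eq_top, Submodule.top_toAddSubgroup]
end

section
/- Let p be a prime, n a positive integer, and A an abelian group such that the group Hom(A, ℤ/p^nℤ) of additive homomorphisms is finitely generated. Then: (a) there exists a finitely generated subgroup B of A such that for every subgroup B' of A containing B the quotient A/B' is p-divisible; and (b) Hom(A, ℤ/p^nℤ) is in fact finite. -/
universe u

/-- Multiplication by `p ^ (n - 1)` embeds `ℤ/p` into `ℤ/p^n`. -/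
theorem exists_injective_zmod_prime_to_zmod_pow {p n : ℕ} (hp : p.Prime) (hn : 0 < n) :
    ∃ f : ZMod p →+ ZMod (p ^ n), Function.Injective f := by
  obtain ⟨k, rfl⟩ := Nat.exists_eq_add_one.mpr hn
  let g : ℤ →+ ZMod (p ^ (k + 1)) := zmultiplesHom _ ((p ^ k : ℕ) : ZMod (p ^ (k + 1)))
  have hg (m : ℤ) : g m = ((m * p ^ k : ℤ) : ZMod (p ^ (k + 1))) := by
    simp [g]
  refine ⟨ZMod.lift p ⟨g, ?_⟩, (ZMod.lift_injective _).mpr fun m hm ↦ ?_⟩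
  · rw [hg, ZMod.intCast_zmod_eq_zero_iff_dvd]
    push_cast
    rw [pow_succ']
  · rw [hg, ZMod.intCast_zmod_eq_zero_iff_dvd] at hm
    push_cast at hm
    rw [pow_succ'] at hm
    rw [ZMod.intCast_zmod_eq_zero_iff_dvd]
    exact Int.dvd_of_mul_dvd_mul_right (pow_ne_zero k (mod_cast hp.ne_zero)) hm

/-- A vector space over a finite field with finite dual is finite. -/
theorem finite_of_finite_dual (K V : Type*) [Field K] [Finite K] [AddCommGroup V] [Module K V]
    [Finite (Module.Dual K V)] : Finite V := by
  have : Module.Finite K V := (Module.finite_dual_iff K).mp inferInstance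
  exact Module.finite_of_finite K

/-- If `Hom(A, ℤ/p^n)` is finite, then so is `A/pA`. -/
theorem finite_quotient_range_nsmul_of_finite_hom {p n : ℕ} (hp : p.Prime) (hn : 0 < n)
    (A : Type*) [AddCommGroup A] [Finite (A →+ ZMod (p ^ n))] :
    Finite (A ⧸ (nsmulAddMonoidHom p : A →+ A).range) := by
  have : Fact p.Prime := ⟨hp⟩
  let V := A ⧸ (nsmulAddMonoidHom p : A →+ A).range
  let _ : Module (ZMod p) V := QuotientAddGroup.zmodModule fun x ↦ ⟨x, rfl⟩
  obtain ⟨f, hf⟩ := exists_injective_zmod_prime_to_zmod_pow hp hn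
  have : Finite (Module.Dual (ZMod p) V) := by
    refine Finite.of_injective
      (fun φ : Module.Dual (ZMod p) V ↦
        f.comp (φ.toAddMonoidHom.comp (QuotientAddGroup.mk' _))) fun φ ψ h ↦ ?_
    ext v
    obtain ⟨a, rfl⟩ := QuotientAddGroup.mk'_surjective _ v
    exact hf (DFunLike.congr_fun h a)
  exact finite_of_finite_dual (ZMod p) V

/-- If `A/pA` is finite, then `A` has a finitely generated subgroup `B` with `A = B + pA`. -/
theorem exists_fg_sup_range_nsmul_eq_top (p : ℕ) (A : Type*) [AddCommGroup A]
    [Finite (A ⧸ (nsmulAddMonoidHom p : A →+ A).range)] :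
    ∃ B : AddSubgroup A, B.FG ∧ B ⊔ (nsmulAddMonoidHom p : A →+ A).range = ⊤ := by
  let s : Set A := Set.range (Quotient.out : A ⧸ (nsmulAddMonoidHom p : A →+ A).range → A)
  refine ⟨AddSubgroup.closure s,
    (AddSubgroup.fg_iff _).mpr ⟨s, rfl, Set.finite_range _⟩, eq_top_iff.mpr fun a _ ↦ ?_⟩
  let q : A ⧸ (nsmulAddMonoidHom p : A →+ A).range := a
  exact AddSubgroup.mem_sup.mpr ⟨q.out, AddSubgroup.subset_closure ⟨q, rfl⟩, -q.out + a,
    QuotientAddGroup.eq.mp (QuotientAddGroup.out_eq' q), add_neg_cancel_left _ _⟩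

/-- If `Hom(A, ℤ/p^n)` is finitely generated, then `A` has a finitely generated
subgroup `B` such that `A/B'` is `p`-divisible for every subgroup `B' ≥ B`, and
`Hom(A, ℤ/p^n)` is in fact finite. -/
theorem exists_fg_subgroup_pDivisible_quotient_of_fg_hom
    (p : ℕ) (hp : Nat.Prime p) (n : ℕ) (hn : 0 < n)
    (A : Type u) [AddCommGroup A]
    (hfg : AddGroup.FG (A →+ ZMod (p ^ n))) :
    (∃ B : AddSubgroup A, B.FG ∧
      ∀ B' : AddSubgroup A, B ≤ B' → ∀ y : A ⧸ B', ∃ x : A ⧸ B', p • x = y) ∧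
    Finite (A →+ ZMod (p ^ n)) := by
  have hfin : Finite (A →+ ZMod (p ^ n)) := by
    refine AddCommGroup.finite_of_fg_isAddTorsion _ fun φ ↦
      isOfFinAddOrder_iff_nsmul_eq_zero.mpr ⟨p ^ n, pow_pos hp.pos n, ?_⟩
    ext a
    simp [nsmul_eq_mul]
  refine ⟨?_, hfin⟩
  have := finite_quotient_range_nsmul_of_finite_hom hp hn A
  obtain ⟨B, hB, hsup⟩ := exists_fg_sup_range_nsmul_eq_top p A
  refine ⟨B, hB, fun B' hle y ↦ ?_⟩
  obtain ⟨a, rfl⟩ := QuotientAddGroup.mk_surjective y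
  obtain ⟨b, hb, _, ⟨x, rfl⟩, rfl⟩ :=
    AddSubgroup.mem_sup.mp (hsup.symm ▸ AddSubgroup.mem_top a)
  refine ⟨x, ?_⟩
  rw [← QuotientAddGroup.mk_nsmul, QuotientAddGroup.mk_add,
    (QuotientAddGroup.eq_zero_iff b).mpr (hle hb), zero_add]
  rfl
end

section
/- Let R be an infinite set of primes and let A be an abelian torsion group that is R-torsion, i.e., every element of A has finite order all of whose prime divisors belong to R. If A is not finitely generated, then the abelian group Ext¹_ℤ(A, ℤ) contains an uncountable subgroup S which is R-local, i.e., for every prime q not in R the map s ↦ q·s is a bijection of S onto itself. -/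
open CategoryTheory

/-- `Ext¹_ℤ(A, B)`, the first Ext group of abelian groups (ℤ-modules). -/
noncomputable abbrev Ext1 (A B : Type) [AddCommGroup A] [AddCommGroup B] : Type :=
  ↥(((Ext ℤ (ModuleCat ℤ) 1).obj (Opposite.op (ModuleCat.of ℤ A))).obj (ModuleCat.of ℤ B))

open HomologicalComplex in
/-- Uncountably many 1-cocycles that are pairwise not cohomologous give uncountable first
cohomology. -/
theorem CochainComplex.uncountable_homology_one {R : Type*} [Ring R]
    (K : CochainComplex (ModuleCat.{0} R) ℕ)
    {T : Type} [Uncountable T] (c : T → K.X 1) (hc : ∀ t, K.d 1 2 (c t) = 0)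
    (hinj : ∀ s t, (∃ b, K.d 0 1 b = c s - c t) → s = t) : Uncountable (K.homology 1) := by
  let e := (K.homologyIsoSc' 0 1 2 (by simp) (by simp)) ≪≫
    (K.sc' 0 1 2).moduleCatHomologyIso
  have : Uncountable (LinearMap.ker (K.sc' 0 1 2).g.hom ⧸
      LinearMap.range (K.sc' 0 1 2).moduleCatToCycles) := by
    refine Function.Injective.uncountable
      (f := fun t ↦ (LinearMap.range (K.sc' 0 1 2).moduleCatToCycles).mkQ ⟨c t, hc t⟩) ?_
    intro s t hst
    obtain ⟨b, hb⟩ := (Submodule.Quotient.eq _).mp hst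
    exact hinj s t ⟨b, congrArg Subtype.val hb⟩
  have : Uncountable (K.sc' 0 1 2).moduleCatLeftHomologyData.H := this
  exact e.toLinearEquiv.symm.injective.uncountable

theorem leftDerived_map_nsmul_id {F : (ModuleCat.{0} ℤ) ⥤ (ModuleCat.{0} ℤ)ᵒᵖ} [F.Additive]
    (X : ModuleCat.{0} ℤ) (n q : ℕ) : (F.leftDerived n).map (q • 𝟙 X) = q • 𝟙 _ := by
  let P := ProjectiveResolution.of X
  rw [F.leftDerived_map_eq n _ (P := P) (Q := P) (q • 𝟙 _) (by
    ext; simp)]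
  have h : (F.mapHomologicalComplex _ ⋙ HomologicalComplex.homologyFunctor _ _ n).map
      (q • 𝟙 P.complex) = q • 𝟙 _ := by
    rw [Functor.map_nsmul, CategoryTheory.Functor.map_id]
  erw [h]
  simp

theorem isIso_nsmul_id_Ext (X Y : ModuleCat.{0} ℤ) (n q : ℕ) [IsIso (q • 𝟙 X)] :
    IsIso (q • 𝟙 (((Ext ℤ (ModuleCat ℤ) n).obj (Opposite.op X)).obj Y)) := by
  have h := leftDerived_map_nsmul_id (F := ((linearYoneda ℤ (ModuleCat ℤ)).obj Y).rightOp) X n q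
  have h2 : IsIso ((((linearYoneda ℤ (ModuleCat ℤ)).obj Y).rightOp.leftDerived n).map (q • 𝟙 X)) :=
    inferInstance
  rw [h] at h2
  exact (isIso_unop_iff _).2 h2

/-- If multiplication by `q` is bijective on `A`, it is bijective on `Extⁿ(A, B)`. -/
theorem Ext_nsmul_bijective (A B : Type) [AddCommGroup A] [AddCommGroup B] (n q : ℕ)
    (hq : Function.Bijective fun a : A ↦ q • a) :
    Function.Bijective fun
      s : (((Ext ℤ (ModuleCat ℤ) n).obj (Opposite.op (ModuleCat.of ℤ A))).obj (ModuleCat.of ℤ B)) ↦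
        q • s := by
  have : IsIso (q • 𝟙 (ModuleCat.of ℤ A)) := (ConcreteCategory.isIso_iff_bijective _).2 hq
  exact (ConcreteCategory.isIso_iff_bijective _).1
    (isIso_nsmul_id_Ext (ModuleCat.of ℤ A) (ModuleCat.of ℤ B) n q)

/-- A prime outside `R` acts bijectively on an `R`-torsion group. -/
theorem nsmul_bijective_of_forall_torsion (R : Set ℕ) (A : Type*) [AddCommGroup A]
    (htors : ∀ a : A, ∃ n : ℕ, 0 < n ∧ n • a = 0 ∧ ∀ q : ℕ, Nat.Prime q → q ∣ n → q ∈ R)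
    {q : ℕ} (hq : q.Prime) (hqR : q ∉ R) : Function.Bijective fun a : A ↦ q • a := by
  have hcop (a : A) : ∃ u v : ℤ, (u * q + v * addOrderOf a) = 1 := by
    obtain ⟨n, -, hna, h⟩ := htors a
    have : Nat.Coprime q (addOrderOf a) := by
      rw [hq.coprime_iff_not_dvd]
      exact fun hd ↦ hqR (h q hq (hd.trans (addOrderOf_dvd_of_nsmul_eq_zero hna)))
    exact Int.isCoprime_iff_gcd_eq_one.2 this
  have key (a : A) : ∃ u : ℤ, u • q • a = a := by
    obtain ⟨u, v, h⟩ := hcop a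
    refine ⟨u, ?_⟩
    have := congrArg (· • a) h
    simpa [add_smul, mul_smul] using this
  constructor
  · refine (injective_iff_map_eq_zero (nsmulAddMonoidHom q : A →+ A)).2 fun a ha ↦ ?_
    obtain ⟨u, hu⟩ := key a
    replace ha : q • a = 0 := ha
    rw [← hu, ha, smul_zero]
  · intro a
    obtain ⟨u, hu⟩ := key a
    exact ⟨u • a, by simpa [smul_comm q u a] using hu⟩

/-- Characters with values in the circle separate points. -/
theorem exists_circle_character_apply_ne_zero {A : Type*} [AddCommGroup A] {a : A} (ha : a ≠ 0) :
    ∃ χ : A →+ Additive Circle, χ a ≠ 0 := by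
  obtain ⟨c, hc⟩ := CharacterModule.exists_character_apply_ne_zero_of_ne_zero ha
  let f : ℚ →+ Additive Circle :=
    (Circle.expHom.comp (AddMonoidHom.mulLeft (2 * Real.pi))).comp (Rat.castHom ℝ).toAddMonoidHom
  have hker : f.ker = AddSubgroup.zmultiples (1 : ℚ) := by
    ext x
    rw [AddMonoidHom.mem_ker]
    change Circle.exp (2 * Real.pi * x) = 1 ↔ _
    rw [Circle.exp_eq_one, AddSubgroup.mem_zmultiples_iff]
    refine exists_congr fun n ↦ ?_
    rw [mul_comm, mul_left_inj' (by positivity)]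
    simp only [zsmul_eq_mul, mul_one]
    rw [eq_comm]
    norm_cast
  refine ⟨(QuotientAddGroup.lift _ f hker.ge).comp c, fun h ↦ hc ?_⟩
  obtain ⟨x, hx⟩ := QuotientAddGroup.mk_surjective (c a)
  rw [← hx]
  refine (QuotientAddGroup.eq_zero_iff x).2 (hker.le ?_)
  change QuotientAddGroup.lift _ f hker.ge (c a) = 0 at h
  rwa [← hx] at h

/-- An abelian group with finitely many circle-valued characters is finite. -/
theorem finite_of_finite_circle_dual {A : Type*} [AddCommGroup A]
    [Finite (A →+ Additive Circle)] : Finite A := by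
  let n := Nat.card (A →+ Additive Circle)
  have hn : 0 < n := Nat.card_pos
  have hfin : Finite {z : Additive Circle // n • z = 0} := by
    have : Finite {w : ℂ // w ∈ Polynomial.nthRootsFinset n (1 : ℂ)} := inferInstance
    refine Finite.of_injective (fun z ↦ (⟨((z.1.toMul : Circle) : ℂ), ?_⟩ :
      {w : ℂ // w ∈ Polynomial.nthRootsFinset n (1 : ℂ)})) fun y z h ↦ ?_
    · rw [Polynomial.mem_nthRootsFinset hn]
      exact congrArg (fun w : Additive Circle ↦ ((w.toMul : Circle) : ℂ)) z.2
    · exact Subtype.ext (Additive.toMul.injective (Circle.ext (by simpa using h)))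
  have hmem (a : A) (χ : A →+ Additive Circle) : n • χ a = 0 := by
    have : n • χ = 0 := card_nsmul_eq_zero'
    exact DFunLike.congr_fun this a
  refine Finite.of_injective
    (fun (a : A) (χ : A →+ Additive Circle) ↦ (⟨χ a, hmem a χ⟩ : {z : Additive Circle // n • z = 0}))
    fun a b hab ↦ ?_
  by_contra hne
  obtain ⟨χ, hχ⟩ := exists_circle_character_apply_ne_zero (sub_ne_zero.2 hne)
  apply hχ
  rw [map_sub, sub_eq_zero]
  exact congrArg Subtype.val (congrFun hab χ)

/-- A countable compact Hausdorff group is finite. -/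
theorem finite_of_countable_of_compactSpace {G : Type*} [Group G] [TopologicalSpace G]
    [IsTopologicalGroup G] [T2Space G] [CompactSpace G] [Countable G] : Finite G := by
  obtain ⟨g, hg⟩ := nonempty_interior_of_iUnion_of_closed
    (f := fun g : G ↦ {g}) (fun _ ↦ isClosed_singleton) (by ext; simp)
  have : IsOpen {g} := by
    rw [← Set.Nonempty.subset_singleton_iff hg |>.1 interior_subset]
    exact isOpen_interior
  have : DiscreteTopology G := discreteTopology_of_isOpen_singleton_one <| by
    simpa using this.preimage (continuous_const_mul g)
  exact finite_of_compact_of_discrete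

/-- The character group of an infinite abelian group is uncountable. -/
theorem uncountable_circle_dual {A : Type*} [AddCommGroup A] [Infinite A] :
    Uncountable (A →+ Additive Circle) := by
  by_contra h
  rw [not_uncountable_iff] at h
  let _ : TopologicalSpace (Multiplicative A) := ⊥
  have : DiscreteTopology (Multiplicative A) := ⟨rfl⟩
  let e : PontryaginDual (Multiplicative A) ≃ (A →+ Additive Circle) :=
    { toFun χ := MonoidHom.toAdditiveRight (χ : Multiplicative A →ₜ* Circle).toMonoidHom
      invFun χ := (⟨MonoidHom.toAdditiveRight.symm χ, continuous_of_discreteTopology⟩ :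
        Multiplicative A →ₜ* Circle)
      left_inv _ := rfl
      right_inv _ := rfl }
  have : Countable (PontryaginDual (Multiplicative A)) := e.countable_iff.2 h
  have : Finite (PontryaginDual (Multiplicative A)) := finite_of_countable_of_compactSpace
  have := Finite.of_equiv _ e
  exact not_finite_iff_infinite.2 ‹Infinite A› finite_of_finite_circle_dual

/-- For an infinite torsion group `A`, the group `Ext¹(A, ℤ)` is uncountable: a character `χ` is sent
to the coboundary of a lift of `χ` to the reals, divided by `2π`. -/
theorem uncountable_Ext_one_int (A : Type) [AddCommGroup A] [Infinite A]
    (htors : ∀ a : A, ∃ n : ℕ, 0 < n ∧ n • a = 0) : Uncountable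
      (((Ext ℤ (ModuleCat ℤ) 1).obj (Opposite.op (ModuleCat.of ℤ A))).obj (ModuleCat.of ℤ ℤ)) := by
  let P := ProjectiveResolution.of (ModuleCat.of ℤ A)
  let p : P.complex.X 0 →+ A := (P.π.f 0).hom.toAddMonoidHom
  let d : P.complex.X 1 →+ P.complex.X 0 := (P.complex.d 1 0).hom.toAddMonoidHom
  have hp : Function.Surjective p := (ModuleCat.epi_iff_surjective (P.π.f 0)).1 inferInstance
  have hdd (x) : d ((P.complex.d 2 1).hom x) = 0 :=
    DFunLike.congr_fun (congrArg ModuleCat.Hom.hom (P.complex.d_comp_d 2 1 0)) x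
  have hexact := (ShortComplex.moduleCat_exact_iff _).1 P.exact₀
  have hpd (x) : p (d x) = 0 :=
    DFunLike.congr_fun (congrArg ModuleCat.Hom.hom P.complex_d_comp_π_f_zero) x
  have hker (x) (hx : p x = 0) : ∃ y, d y = x := hexact x hx
  have hexp : Function.Surjective Circle.expHom := fun z ↦
    ⟨_, congrArg Additive.ofMul (Circle.exp_arg z.toMul)⟩
  have hlift (χ : A →+ Additive Circle) : ∃ f : P.complex.X 0 →+ ℝ,
      ∀ x, Circle.expHom (f x) = χ (p x) := by
    let e := ModuleCat.ofHom Circle.expHom.toIntLinearMap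
    have : Epi e := (ModuleCat.epi_iff_surjective e).2 hexp
    let u := P.π.f 0 ≫ (ModuleCat.ofHom χ.toIntLinearMap : ModuleCat.of ℤ A ⟶ _)
    exact ⟨(Projective.factorThru u e).hom.toAddMonoidHom, fun x ↦
      DFunLike.congr_fun (congrArg ModuleCat.Hom.hom (Projective.factorThru_comp u e)) x⟩
  choose f hf using hlift
  have hpi : 2 * Real.pi ≠ 0 := by positivity
  have hint (χ : A →+ Additive Circle) : ∃ g : P.complex.X 1 ⟶ ModuleCat.of ℤ ℤ,
      ∀ x, f χ (d x) = (g.hom x : ℤ) * (2 * Real.pi) := by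
    have h (x) : ∃ n : ℤ, f χ (d x) = n * (2 * Real.pi) := by
      rw [← Circle.exp_eq_one]
      exact (hf χ (d x)).trans (by rw [hpd, map_zero]; rfl)
    choose g hg using h
    let g' : P.complex.X 1 →+ ℤ := AddMonoidHom.mk' g fun x y ↦ by
      have := hg (x + y)
      rw [map_add, map_add, hg, hg, ← add_mul, mul_left_inj' hpi] at this
      exact_mod_cast this.symm
    exact ⟨ModuleCat.ofHom { g' with
      map_smul' := fun n x ↦ (congrArg g' (int_smul_eq_zsmul _ n x)).trans (map_zsmul g' n x) }, hg⟩
  choose g hg using hint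
  have : Uncountable (A →+ Additive Circle) := uncountable_circle_dual
  have h : Uncountable ((P.complex.linearYonedaObj ℤ (ModuleCat.of ℤ ℤ)).homology 1) := by
    refine CochainComplex.uncountable_homology_one _
      (T := A →+ Additive Circle) (g) (fun χ ↦ ?_) ?_
    · refine ModuleCat.hom_ext (LinearMap.ext fun x ↦ ?_)
      change (g χ).hom ((P.complex.d 2 1).hom x) = 0
      have := hg χ ((P.complex.d 2 1).hom x)
      rw [hdd, map_zero, zero_eq_mul, or_iff_left hpi] at this
      exact_mod_cast this
    · rintro χ ψ ⟨b, hb⟩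
      let b' : P.complex.X 0 →+ ℤ := (ModuleCat.Hom.hom b).toAddMonoidHom
      have hb' (x) : b' (d x) = (g χ).hom x - (g ψ).hom x :=
        DFunLike.congr_fun (congrArg ModuleCat.Hom.hom hb) x
      ext1 a
      obtain ⟨x, rfl⟩ := hp a
      obtain ⟨n, hn, hna⟩ := htors (p x)
      obtain ⟨y, hy⟩ := hker (n • x) (by rw [map_nsmul, hna])
      have key : f χ x = f ψ x + b' x * (2 * Real.pi) := by
        have h1 := hg χ y
        have h2 := hg ψ y
        have h3 : (b' (d y) : ℝ) = ((g χ).hom y : ℤ) - ((g ψ).hom y : ℤ) := by exact_mod_cast hb' y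
        rw [hy, map_nsmul, nsmul_eq_mul] at h1 h2 h3
        push_cast at h3
        have hn' : (n : ℝ) ≠ 0 := by exact_mod_cast hn.ne'
        apply mul_left_cancel₀ hn'
        linear_combination h1 - h2 - (2 * Real.pi) * h3
      rw [← hf, ← hf, key, map_add]
      have : Circle.expHom (b' x * (2 * Real.pi)) = 0 := Circle.exp_eq_one.2 ⟨_, rfl⟩
      rw [this, add_zero]
  exact (P.isoExt (R := ℤ) 1 (ModuleCat.of ℤ ℤ)).toLinearEquiv.symm.injective.uncountable

/-- If `A` is an `R`-torsion abelian group (`R` an infinite set of primes) which is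
not finitely generated, then `Ext¹_ℤ(A, ℤ)` contains an uncountable `R`-local
subgroup. -/
theorem ext_contains_uncountable_local_subgroup
    (R : Set ℕ) (hR : ∀ r ∈ R, Nat.Prime r) (hRinf : R.Infinite)
    (A : Type) [AddCommGroup A]
    (htors : ∀ a : A, ∃ n : ℕ, 0 < n ∧ n • a = 0 ∧ ∀ q : ℕ, Nat.Prime q → q ∣ n → q ∈ R)
    (hnfg : ¬ AddGroup.FG A) :
    ∃ S : AddSubgroup (Ext1 A ℤ), ¬ Countable ↥S ∧
      ∀ q : ℕ, Nat.Prime q → q ∉ R → Function.Bijective fun s : ↥S => q • s := by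
  have hinf : Infinite A := by
    rw [← not_finite_iff_infinite]
    intro
    exact hnfg inferInstance
  have hunc := uncountable_Ext_one_int A fun a ↦ (htors a).imp fun _ h ↦ ⟨h.1, h.2.1⟩
  refine ⟨⊤, fun _ ↦ not_countable (α := Ext1 A ℤ)
    (AddSubgroup.topEquiv (G := Ext1 A ℤ)).symm.injective.countable, fun q hq hqR ↦ ?_⟩
  have h := Ext_nsmul_bijective A ℤ 1 q (nsmul_bijective_of_forall_torsion R A htors hq hqR)
  refine ⟨fun x y hxy ↦ Subtype.ext (h.1 (congrArg Subtype.val hxy)), fun y ↦ ?_⟩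
  obtain ⟨x, hx⟩ := h.2 y
  exact ⟨⟨x, trivial⟩, Subtype.ext hx⟩
end

section
/- Let Y be a Hausdorff topological space equipped with a group structure (μ, inv, y₀) such that the inversion inv : Y → Y is continuous and, for every compact subset C ⊆ Y, the restrictions of the multiplication μ : Y × Y → Y to Y × C and to C × Y are continuous (i.e., Y is a quasitopological group). Let K be a compact Hausdorff space, and endow the set C(K,Y) of continuous maps with the compact-open topology and the pointwise operations M(f,g)(x) = μ(f(x),g(x)) and I(f) = inv ∘ f; these operations are well defined (M(f,g) and I(f) are continuous maps K → Y). Then C(K,Y) with unit the constant map at y₀ is again a quasitopological group: I is continuous and, for every compact subset Γ ⊆ C(K,Y), the restrictions of M to C(K,Y) × Γ and to Γ × C(K,Y) are continuous. Moreover, for any subset A ⊆ K the set {f ∈ C(K,Y) : f(a) = y₀ for all a ∈ A} is a closed subgroup with the same property. -/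
universe u v

/-- Pointwise application of a binary operation to continuous families of maps is continuous
where the operation is continuous on a set containing all the values. -/
lemma ContinuousMap.continuousOn_pointwise {K X Y Z : Type*} [TopologicalSpace K]
    [LocallyCompactSpace K] [TopologicalSpace X] [TopologicalSpace Y] [TopologicalSpace Z]
    {μ : Y → Y → Z} {S : Set (Y × Y)} (hμ : ContinuousOn (fun z : Y × Y => μ z.1 z.2) S)
    {M : C(K, Y) → C(K, Y) → C(K, Z)} (hM : ∀ f g x, M f g x = μ (f x) (g x))
    {F G : X → C(K, Y)} {T : Set X} (hF : ContinuousOn F T) (hG : ContinuousOn G T)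
    (hS : ∀ z ∈ T, ∀ x, (F z x, G z x) ∈ S) :
    ContinuousOn (fun z => M (F z) (G z)) T := by
  rw [continuousOn_iff_continuous_domRestrict] at hF hG ⊢
  refine ContinuousMap.continuous_of_continuous_uncurry _ ?_
  have hFG : Continuous fun p : T × K => (F p.1 p.2, G p.1 p.2) :=
    ((hF.comp continuous_fst).eval continuous_snd).prodMk
      ((hG.comp continuous_fst).eval continuous_snd)
  refine (hμ.comp_continuous hFG fun p => hS _ p.1.2 p.2).congr fun p => ?_
  exact (hM _ _ _).symm

/-- The values of a compact family of maps on a compact space form a compact set. -/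
lemma ContinuousMap.isCompact_image_eval {K Y : Type*} [TopologicalSpace K] [CompactSpace K]
    [LocallyCompactSpace K] [TopologicalSpace Y] {Γ : Set C(K, Y)} (hΓ : IsCompact Γ) :
    IsCompact ((fun p : C(K, Y) × K => p.1 p.2) '' (Γ ×ˢ Set.univ)) :=
  (hΓ.prod isCompact_univ).image (continuous_fst.eval continuous_snd)

/-- For a quasitopological group `Y` (Hausdorff, multiplication continuous on `Y × C`
and `C × Y` for each compact `C`, inversion continuous) and a compact Hausdorff space
`K`, the mapping space `C(K, Y)` with the compact-open topology and pointwise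
operations is again a quasitopological group, and for every `A ⊆ K` the based maps
`{f | f(A) = y₀}` form a closed quasitopological subgroup. -/
theorem mappingSpace_quasitopological_group
    (Y : Type u) [TopologicalSpace Y] [T2Space Y]
    (μ : Y → Y → Y) (inv : Y → Y) (y₀ : Y)
    (hassoc : ∀ a b c : Y, μ (μ a b) c = μ a (μ b c))
    (hunit_left : ∀ a : Y, μ y₀ a = a) (hunit_right : ∀ a : Y, μ a y₀ = a)
    (hinv_left : ∀ a : Y, μ (inv a) a = y₀)
    (hinv_cont : Continuous inv)
    (hμ_cont : ∀ Cs : Set Y, IsCompact Cs →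
      ContinuousOn (fun z : Y × Y => μ z.1 z.2) (Set.univ ×ˢ Cs) ∧
      ContinuousOn (fun z : Y × Y => μ z.1 z.2) (Cs ×ˢ Set.univ))
    (K : Type v) [TopologicalSpace K] [CompactSpace K] [T2Space K] :
    ∃ (M : C(K, Y) → C(K, Y) → C(K, Y)) (I : C(K, Y) → C(K, Y)),
      (∀ (f g : C(K, Y)) (x : K), M f g x = μ (f x) (g x)) ∧
      (∀ (f : C(K, Y)) (x : K), I f x = inv (f x)) ∧
      Continuous I ∧
      (∀ Γ : Set C(K, Y), IsCompact Γ →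
        ContinuousOn (fun z : C(K, Y) × C(K, Y) => M z.1 z.2) (Set.univ ×ˢ Γ) ∧
        ContinuousOn (fun z : C(K, Y) × C(K, Y) => M z.1 z.2) (Γ ×ˢ Set.univ)) ∧
      (∀ f g h : C(K, Y), M (M f g) h = M f (M g h)) ∧
      (∀ f : C(K, Y), M (ContinuousMap.const K y₀) f = f) ∧
      (∀ f : C(K, Y), M f (ContinuousMap.const K y₀) = f) ∧
      (∀ f : C(K, Y), M (I f) f = ContinuousMap.const K y₀) ∧
      T2Space C(K, Y) ∧
      ∀ A : Set K,
        IsClosed { f : C(K, Y) | ∀ a ∈ A, f a = y₀ } ∧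
        ContinuousMap.const K y₀ ∈ { f : C(K, Y) | ∀ a ∈ A, f a = y₀ } ∧
        (∀ f g : C(K, Y), f ∈ { f : C(K, Y) | ∀ a ∈ A, f a = y₀ } →
          g ∈ { f : C(K, Y) | ∀ a ∈ A, f a = y₀ } →
          M f g ∈ { f : C(K, Y) | ∀ a ∈ A, f a = y₀ }) ∧
        (∀ f : C(K, Y), f ∈ { f : C(K, Y) | ∀ a ∈ A, f a = y₀ } →
          I f ∈ { f : C(K, Y) | ∀ a ∈ A, f a = y₀ }) ∧
        (∀ Γ : Set ↥{ f : C(K, Y) | ∀ a ∈ A, f a = y₀ }, IsCompact Γ →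
          ContinuousOn
            (fun z : ↥{ f : C(K, Y) | ∀ a ∈ A, f a = y₀ } ×
                ↥{ f : C(K, Y) | ∀ a ∈ A, f a = y₀ } => M z.1.1 z.2.1)
            (Set.univ ×ˢ Γ) ∧
          ContinuousOn
            (fun z : ↥{ f : C(K, Y) | ∀ a ∈ A, f a = y₀ } ×
                ↥{ f : C(K, Y) | ∀ a ∈ A, f a = y₀ } => M z.1.1 z.2.1)
            (Γ ×ˢ Set.univ)) := by
  have hM_cont (f g : C(K, Y)) : Continuous fun x => μ (f x) (g x) :=
    (hμ_cont _ (isCompact_range g.continuous)).1.comp_continuous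
      (f.continuous.prodMk g.continuous) fun x => ⟨Set.mem_univ _, Set.mem_range_self x⟩
  let M (f g : C(K, Y)) : C(K, Y) := ⟨fun x => μ (f x) (g x), hM_cont f g⟩
  have hM (f g : C(K, Y)) (x : K) : M f g x = μ (f x) (g x) := rfl
  have hinv_unit : inv y₀ = y₀ := (hunit_right _).symm.trans (hinv_left y₀)
  have hM_compact (Γ : Set C(K, Y)) (hΓ : IsCompact Γ) :
      ContinuousOn (fun z : C(K, Y) × C(K, Y) => M z.1 z.2) (Set.univ ×ˢ Γ) ∧
      ContinuousOn (fun z : C(K, Y) × C(K, Y) => M z.1 z.2) (Γ ×ˢ Set.univ) := by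
    have hμΓ := hμ_cont _ (ContinuousMap.isCompact_image_eval hΓ)
    constructor
    · exact ContinuousMap.continuousOn_pointwise hμΓ.1 hM continuousOn_fst continuousOn_snd
        fun z hz x => ⟨Set.mem_univ _, (z.2, x), ⟨hz.2, Set.mem_univ _⟩, rfl⟩
    · exact ContinuousMap.continuousOn_pointwise hμΓ.2 hM continuousOn_fst continuousOn_snd
        fun z hz x => ⟨⟨(z.1, x), ⟨hz.1, Set.mem_univ _⟩, rfl⟩, Set.mem_univ _⟩
  refine ⟨M, fun f => ⟨inv ∘ f, hinv_cont.comp f.continuous⟩, hM, fun _ _ => rfl,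
    ContinuousMap.continuous_postcomp ⟨inv, hinv_cont⟩, hM_compact,
    fun f g h => ContinuousMap.ext fun x => hassoc _ _ _,
    fun f => ContinuousMap.ext fun x => hunit_left _,
    fun f => ContinuousMap.ext fun x => hunit_right _,
    fun f => ContinuousMap.ext fun x => hinv_left _, inferInstance, fun A => ⟨?_, ?_, ?_, ?_, ?_⟩⟩
  · simp only [Set.ofPred_forall]
    exact isClosed_biInter fun a _ =>
      isClosed_eq (continuous_eval_const a) continuous_const
  · exact fun _ _ => rfl
  · intro f g hf hg a ha
    rw [hM, hf a ha, hg a ha, hunit_left]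
  · intro f hf a ha
    exact (congrArg inv (hf a ha)).trans hinv_unit
  · intro Γ hΓ
    have hval := (continuous_subtype_val (p := (· ∈ { f : C(K, Y) | ∀ a ∈ A, f a = y₀ })))
    have hΓM := hM_compact _ (hΓ.image hval)
    constructor
    · exact hΓM.1.comp (hval.prodMap hval).continuousOn
        fun z hz => ⟨Set.mem_univ _, Set.mem_image_of_mem _ hz.2⟩
    · exact hΓM.2.comp (hval.prodMap hval).continuousOn
        fun z hz => ⟨Set.mem_image_of_mem _ hz.1, Set.mem_univ _⟩
end
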